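/- arXiv:1807.07063 — 2 statements merged into one kernel-verified Lean document; each statement's English description precedes it below -/
import Mathlib

section
/- First explicit blowup family for the 3D incompressible Navier–Stokes equations (Proposition 2.1, first family, in Cartesian form): let T* > 0, ν ≥ 0, and a, k ∈ ℝ ∖ {0}. Define, for 0 ≤ t < T* and x ∈ ℝ³ with x₁² + x₂² ≠ 0: v(t,x) = (a x₁/(T*−t) + k x₂/(x₁²+x₂²), a x₂/(T*−t) − k x₁/(x₁²+x₂²), −2a x₃/(T*−t)) and P(t,x) = −(1/2)(a(a+1)(x₁²+x₂²)/(T*−t)² + k²/(x₁²+x₂²)) + a(1−2a) x₃²/(T*−t)². Then at every such point ∂ₜv + (v·∇)v + ∇P = νΔv and ∇·v = 0. -/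
set_option linter.unusedVariables false

open Real Filter

noncomputable section

/-- Scalar fields on spacetime, in curried form `f t x₁ x₂ x₃`. -/
abbrev F : Type := ℝ → ℝ → ℝ → ℝ → ℝ

/-- Time partial derivative `∂ₜ`. -/
def pdt (f : F) : F := fun t x1 x2 x3 => deriv (fun s => f s x1 x2 x3) t

/-- Spatial partial derivative `∂_{x₁}`. -/
def pd1 (f : F) : F := fun t x1 x2 x3 => deriv (fun y => f t y x2 x3) x1

/-- Spatial partial derivative `∂_{x₂}`. -/
def pd2 (f : F) : F := fun t x1 x2 x3 => deriv (fun y => f t x1 y x3) x2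

/-- Spatial partial derivative `∂_{x₃}`. -/
def pd3 (f : F) : F := fun t x1 x2 x3 => deriv (fun y => f t x1 x2 y) x3

/-- Spatial Laplacian `Δ = ∂₁² + ∂₂² + ∂₃²`. -/
def lap (f : F) : F := fun t x1 x2 x3 =>
  pd1 (pd1 f) t x1 x2 x3 + pd2 (pd2 f) t x1 x2 x3 + pd3 (pd3 f) t x1 x2 x3

/-- Spatial divergence `∇·u` of a vector field `u = (u1, u2, u3)`. -/
def divg (u1 u2 u3 : F) : F := fun t x1 x2 x3 =>
  pd1 u1 t x1 x2 x3 + pd2 u2 t x1 x2 x3 + pd3 u3 t x1 x2 x3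

/-- First component of the spatial curl `∇×u`. -/
def curl1 (u1 u2 u3 : F) : F := fun t x1 x2 x3 => pd2 u3 t x1 x2 x3 - pd3 u2 t x1 x2 x3

/-- Second component of the spatial curl `∇×u`. -/
def curl2 (u1 u2 u3 : F) : F := fun t x1 x2 x3 => pd3 u1 t x1 x2 x3 - pd1 u3 t x1 x2 x3

/-- Third component of the spatial curl `∇×u`. -/
def curl3 (u1 u2 u3 : F) : F := fun t x1 x2 x3 => pd1 u2 t x1 x2 x3 - pd2 u1 t x1 x2 x3

/-- First component of the pointwise cross product `a × b`. -/
def cr1 (a1 a2 a3 b1 b2 b3 : F) : F := fun t x1 x2 x3 =>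
  a2 t x1 x2 x3 * b3 t x1 x2 x3 - a3 t x1 x2 x3 * b2 t x1 x2 x3

/-- Second component of the pointwise cross product `a × b`. -/
def cr2 (a1 a2 a3 b1 b2 b3 : F) : F := fun t x1 x2 x3 =>
  a3 t x1 x2 x3 * b1 t x1 x2 x3 - a1 t x1 x2 x3 * b3 t x1 x2 x3

/-- Third component of the pointwise cross product `a × b`. -/
def cr3 (a1 a2 a3 b1 b2 b3 : F) : F := fun t x1 x2 x3 =>
  a1 t x1 x2 x3 * b2 t x1 x2 x3 - a2 t x1 x2 x3 * b1 t x1 x2 x3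

/-- The momentum equation `∂ₜv + (v·∇)v + ∇P = ν Δv + (∇×H)×H` of the 3D incompressible
MHD system with viscosity `ν`, at the point `(t, x1, x2, x3)` (all three components). -/
def momEq (ν : ℝ) (v1 v2 v3 H1 H2 H3 P : F) (t x1 x2 x3 : ℝ) : Prop :=
  (pdt v1 t x1 x2 x3 + v1 t x1 x2 x3 * pd1 v1 t x1 x2 x3 + v2 t x1 x2 x3 * pd2 v1 t x1 x2 x3 +
      v3 t x1 x2 x3 * pd3 v1 t x1 x2 x3 + pd1 P t x1 x2 x3 =
    ν * lap v1 t x1 x2 x3 +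
      (curl2 H1 H2 H3 t x1 x2 x3 * H3 t x1 x2 x3 - curl3 H1 H2 H3 t x1 x2 x3 * H2 t x1 x2 x3)) ∧
  (pdt v2 t x1 x2 x3 + v1 t x1 x2 x3 * pd1 v2 t x1 x2 x3 + v2 t x1 x2 x3 * pd2 v2 t x1 x2 x3 +
      v3 t x1 x2 x3 * pd3 v2 t x1 x2 x3 + pd2 P t x1 x2 x3 =
    ν * lap v2 t x1 x2 x3 +
      (curl3 H1 H2 H3 t x1 x2 x3 * H1 t x1 x2 x3 - curl1 H1 H2 H3 t x1 x2 x3 * H3 t x1 x2 x3)) ∧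
  (pdt v3 t x1 x2 x3 + v1 t x1 x2 x3 * pd1 v3 t x1 x2 x3 + v2 t x1 x2 x3 * pd2 v3 t x1 x2 x3 +
      v3 t x1 x2 x3 * pd3 v3 t x1 x2 x3 + pd3 P t x1 x2 x3 =
    ν * lap v3 t x1 x2 x3 +
      (curl1 H1 H2 H3 t x1 x2 x3 * H2 t x1 x2 x3 - curl2 H1 H2 H3 t x1 x2 x3 * H1 t x1 x2 x3))

/-- The induction equation `∂ₜH = ν ΔH + ∇×(v×H)` of the 3D incompressible MHD system
with viscosity `ν`, at the point `(t, x1, x2, x3)` (all three components). -/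
def indEq (ν : ℝ) (v1 v2 v3 H1 H2 H3 : F) (t x1 x2 x3 : ℝ) : Prop :=
  (pdt H1 t x1 x2 x3 = ν * lap H1 t x1 x2 x3 +
      curl1 (cr1 v1 v2 v3 H1 H2 H3) (cr2 v1 v2 v3 H1 H2 H3) (cr3 v1 v2 v3 H1 H2 H3) t x1 x2 x3) ∧
  (pdt H2 t x1 x2 x3 = ν * lap H2 t x1 x2 x3 +
      curl2 (cr1 v1 v2 v3 H1 H2 H3) (cr2 v1 v2 v3 H1 H2 H3) (cr3 v1 v2 v3 H1 H2 H3) t x1 x2 x3) ∧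
  (pdt H3 t x1 x2 x3 = ν * lap H3 t x1 x2 x3 +
      curl3 (cr1 v1 v2 v3 H1 H2 H3) (cr2 v1 v2 v3 H1 H2 H3) (cr3 v1 v2 v3 H1 H2 H3) t x1 x2 x3)

/-- The momentum equation `∂ₜv + (v·∇)v + ∇P = ν Δv` of the 3D incompressible
Navier–Stokes equations with viscosity `ν`, at a point (all three components). -/
def nsMomEq (ν : ℝ) (v1 v2 v3 P : F) (t x1 x2 x3 : ℝ) : Prop :=
  (pdt v1 t x1 x2 x3 + v1 t x1 x2 x3 * pd1 v1 t x1 x2 x3 + v2 t x1 x2 x3 * pd2 v1 t x1 x2 x3 +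
      v3 t x1 x2 x3 * pd3 v1 t x1 x2 x3 + pd1 P t x1 x2 x3 = ν * lap v1 t x1 x2 x3) ∧
  (pdt v2 t x1 x2 x3 + v1 t x1 x2 x3 * pd1 v2 t x1 x2 x3 + v2 t x1 x2 x3 * pd2 v2 t x1 x2 x3 +
      v3 t x1 x2 x3 * pd3 v2 t x1 x2 x3 + pd2 P t x1 x2 x3 = ν * lap v2 t x1 x2 x3) ∧
  (pdt v3 t x1 x2 x3 + v1 t x1 x2 x3 * pd1 v3 t x1 x2 x3 + v2 t x1 x2 x3 * pd2 v3 t x1 x2 x3 +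
      v3 t x1 x2 x3 * pd3 v3 t x1 x2 x3 + pd3 P t x1 x2 x3 = ν * lap v3 t x1 x2 x3)

/-- The full 3D incompressible MHD system with viscosity `ν` on all of `ℝ × ℝ³`:
momentum equation, induction equation, and the divergence-free conditions. -/
def MHDSystem (ν : ℝ) (v1 v2 v3 H1 H2 H3 P : F) : Prop :=
  ∀ t x1 x2 x3 : ℝ,
    momEq ν v1 v2 v3 H1 H2 H3 P t x1 x2 x3 ∧ indEq ν v1 v2 v3 H1 H2 H3 t x1 x2 x3 ∧
      divg v1 v2 v3 t x1 x2 x3 = 0 ∧ divg H1 H2 H3 t x1 x2 x3 = 0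

/-- Smoothness of a scalar field on `ℝ × ℝ³` (curried form). -/
def Smooth4 (f : F) : Prop :=
  ContDiff ℝ (⊤ : ℕ∞) (fun p : ℝ × ℝ × ℝ × ℝ => f p.1 p.2.1 p.2.2.1 p.2.2.2)

/-- First explicit family: first velocity component. -/
def V1 (T a k : ℝ) : F := fun t x1 x2 x3 => a * x1 / (T - t) + k * x2 / (x1 ^ 2 + x2 ^ 2)

/-- First explicit family: second velocity component. -/
def V2 (T a k : ℝ) : F := fun t x1 x2 x3 => a * x2 / (T - t) - k * x1 / (x1 ^ 2 + x2 ^ 2)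

/-- First explicit family: third velocity component. -/
def V3 (T a : ℝ) : F := fun t x1 x2 x3 => -(2 * a * x3) / (T - t)

/-- First explicit family: first magnetic field component. -/
def B1 (T a k ab : ℝ) : F := fun t x1 x2 x3 =>
  ab * x1 + 2 * ab * k * x2 * (T - t) / ((2 * a + 1) * (x1 ^ 2 + x2 ^ 2))

/-- First explicit family: second magnetic field component. -/
def B2 (T a k ab : ℝ) : F := fun t x1 x2 x3 =>
  ab * x2 - 2 * ab * k * x1 * (T - t) / ((2 * a + 1) * (x1 ^ 2 + x2 ^ 2))

/-- First explicit family: third magnetic field component. -/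
def B3 (ab : ℝ) : F := fun t x1 x2 x3 => -(2 * ab * x3)

/-- First explicit family: the pressure. -/
def Pr1 (T a k : ℝ) : F := fun t x1 x2 x3 =>
  -(1 / 2) * (a * (a + 1) * (x1 ^ 2 + x2 ^ 2) / (T - t) ^ 2 + k ^ 2 / (x1 ^ 2 + x2 ^ 2)) +
    a * (1 - 2 * a) * x3 ^ 2 / (T - t) ^ 2

/-- The punctured-axis condition is open along lines parallel to the first axis. -/
lemma eventually_sq_add_sq_ne_zero {x y : ℝ} (h : x ^ 2 + y ^ 2 ≠ 0) :
    ∀ᶠ z in nhds x, z ^ 2 + y ^ 2 ≠ 0 :=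
  ContinuousAt.eventually_ne (by fun_prop) h

lemma hasDerivAt_sq_add_const (x c : ℝ) : HasDerivAt (fun z : ℝ => z ^ 2 + c) (2 * x) x := by
  simpa using (hasDerivAt_pow 2 x).add_const c

lemma hasDerivAt_const_sub_inv {T t : ℝ} (c : ℝ) (h : T - t ≠ 0) :
    HasDerivAt (fun s => c / (T - s)) (c / (T - t) ^ 2) t := by
  refine ((hasDerivAt_const t c).div ((hasDerivAt_id t).const_sub T) h).congr_deriv ?_
  simp

/-- Derivative of `(p z + q) / (z² + c)`. -/
lemma hasDerivAt_affine_div {x c : ℝ} (p q : ℝ) (h : x ^ 2 + c ≠ 0) :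
    HasDerivAt (fun z => (p * z + q) / (z ^ 2 + c))
      ((p * (x ^ 2 + c) - (p * x + q) * (2 * x)) / (x ^ 2 + c) ^ 2) x := by
  have hn : HasDerivAt (fun z : ℝ => p * z + q) p x := by
    simpa using ((hasDerivAt_id x).const_mul p).add_const q
  exact hn.div (hasDerivAt_sq_add_const x c) h

/-- Derivative of `(p z + q) / (z² + c)` plus an affine function. -/
lemma deriv_affine_div_add {x c : ℝ} (p q m n : ℝ) (h : x ^ 2 + c ≠ 0) :
    deriv (fun z => m * z + n + (p * z + q) / (z ^ 2 + c)) x =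
      m + (p * (x ^ 2 + c) - (p * x + q) * (2 * x)) / (x ^ 2 + c) ^ 2 := by
  have hm : HasDerivAt (fun z : ℝ => m * z + n) m x := by
    simpa using ((hasDerivAt_id x).const_mul m).add_const n
  exact (hm.add (hasDerivAt_affine_div p q h)).deriv

/-- Second derivative of `(p z + q) / (z² + y²)` plus an affine function. -/
lemma deriv_deriv_affine_div_add {x y : ℝ} (p q m n : ℝ) (h : x ^ 2 + y ^ 2 ≠ 0) :
    deriv (fun w => deriv (fun z => m * z + n + (p * z + q) / (z ^ 2 + y ^ 2)) w) x =
      (-(4 * p * x + 2 * q) * (x ^ 2 + y ^ 2) ^ 2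
        - (p * (x ^ 2 + y ^ 2) - (p * x + q) * (2 * x)) * (4 * x * (x ^ 2 + y ^ 2)) +
          2 * p * x * (x ^ 2 + y ^ 2) ^ 2) / (x ^ 2 + y ^ 2) ^ 4 := by
  have he : (fun w => deriv (fun z => m * z + n + (p * z + q) / (z ^ 2 + y ^ 2)) w) =ᶠ[nhds x]
      fun w => m + (p * (w ^ 2 + y ^ 2) - (p * w + q) * (2 * w)) / (w ^ 2 + y ^ 2) ^ 2 := by
    filter_upwards [eventually_sq_add_sq_ne_zero h] with w hw
    exact deriv_affine_div_add p q m n hw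
  rw [he.deriv_eq]
  have hd := hasDerivAt_sq_add_const x (y ^ 2)
  have hn : HasDerivAt (fun w : ℝ => p * w + q) p x := by
    simpa using ((hasDerivAt_id x).const_mul p).add_const q
  have h2 : HasDerivAt (fun w : ℝ => 2 * w) 2 x := by
    simpa using (hasDerivAt_id x).const_mul (2 : ℝ)
  have H := ((((hd.const_mul p).sub (hn.mul h2)).div (hd.pow 2) (pow_ne_zero 2 h)).const_add m).deriv
  refine Eq.trans H ?_
  simp only [Pi.mul_apply, Pi.sub_apply, Pi.pow_apply]
  field_simp
  ring

section
variable (T a k t x1 x2 x3 : ℝ)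

lemma V1_eq_fst : (fun y => V1 T a k t y x2 x3) =
    fun z => a / (T - t) * z + 0 + (0 * z + k * x2) / (z ^ 2 + x2 ^ 2) := by
  funext z; simp only [V1]; ring

lemma V1_eq_snd : (fun y => V1 T a k t x1 y x3) =
    fun z => 0 * z + a * x1 / (T - t) + (k * z + 0) / (z ^ 2 + x1 ^ 2) := by
  funext z; simp only [V1]; ring

lemma V2_eq_fst : (fun y => V2 T a k t y x2 x3) =
    fun z => 0 * z + a * x2 / (T - t) + (-k * z + 0) / (z ^ 2 + x2 ^ 2) := by
  funext z; simp only [V2]; ring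

lemma V2_eq_snd : (fun y => V2 T a k t x1 y x3) =
    fun z => a / (T - t) * z + 0 + (0 * z + -k * x1) / (z ^ 2 + x1 ^ 2) := by
  funext z; simp only [V2]; ring

lemma pd3_V1 : pd3 (V1 T a k) = 0 := by
  funext t x1 x2 x3; simp [pd3, V1]

lemma pd3_V2 : pd3 (V2 T a k) = 0 := by
  funext t x1 x2 x3; simp [pd3, V2]

lemma pd1_V3 : pd1 (V3 T a) = 0 := by
  funext t x1 x2 x3; simp [pd1, V3]

lemma pd2_V3 : pd2 (V3 T a) = 0 := by
  funext t x1 x2 x3; simp [pd2, V3]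

lemma pd3_V3 : pd3 (V3 T a) = fun t _ _ _ => -(2 * a) / (T - t) := by
  funext t x1 x2 x3
  have h : (fun y => V3 T a t x1 x2 y) = fun y => -(2 * a) / (T - t) * y := by
    funext y; simp only [V3]; ring
  simp [pd3, h]

variable {T t x1 x2}

lemma pdt_V1 (h : T - t ≠ 0) : pdt (V1 T a k) t x1 x2 x3 = a * x1 / (T - t) ^ 2 :=
  ((hasDerivAt_const_sub_inv (a * x1) h).add_const _).deriv

lemma pdt_V2 (h : T - t ≠ 0) : pdt (V2 T a k) t x1 x2 x3 = a * x2 / (T - t) ^ 2 :=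
  ((hasDerivAt_const_sub_inv (a * x2) h).sub_const _).deriv

lemma pdt_V3 (h : T - t ≠ 0) : pdt (V3 T a) t x1 x2 x3 = -(2 * a * x3) / (T - t) ^ 2 :=
  (hasDerivAt_const_sub_inv (-(2 * a * x3)) h).deriv

lemma pd1_V1 (h : x1 ^ 2 + x2 ^ 2 ≠ 0) : pd1 (V1 T a k) t x1 x2 x3 =
    a / (T - t) - 2 * k * x1 * x2 / (x1 ^ 2 + x2 ^ 2) ^ 2 := by
  rw [pd1, V1_eq_fst, deriv_affine_div_add _ _ _ _ h]; ring

lemma pd2_V1 (h : x1 ^ 2 + x2 ^ 2 ≠ 0) : pd2 (V1 T a k) t x1 x2 x3 =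
    k * (x1 ^ 2 - x2 ^ 2) / (x1 ^ 2 + x2 ^ 2) ^ 2 := by
  rw [pd2, V1_eq_snd, deriv_affine_div_add _ _ _ _ (by rwa [add_comm]), add_comm (x2 ^ 2)]; ring

lemma pd1_V2 (h : x1 ^ 2 + x2 ^ 2 ≠ 0) : pd1 (V2 T a k) t x1 x2 x3 =
    k * (x1 ^ 2 - x2 ^ 2) / (x1 ^ 2 + x2 ^ 2) ^ 2 := by
  rw [pd1, V2_eq_fst, deriv_affine_div_add _ _ _ _ h]; ring

lemma pd2_V2 (h : x1 ^ 2 + x2 ^ 2 ≠ 0) : pd2 (V2 T a k) t x1 x2 x3 =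
    a / (T - t) + 2 * k * x1 * x2 / (x1 ^ 2 + x2 ^ 2) ^ 2 := by
  rw [pd2, V2_eq_snd, deriv_affine_div_add _ _ _ _ (by rwa [add_comm]), add_comm (x2 ^ 2)]; ring

/-- Away from the axis the first velocity component is harmonic. -/
lemma lap_V1 (h : x1 ^ 2 + x2 ^ 2 ≠ 0) : lap (V1 T a k) t x1 x2 x3 = 0 := by
  have h' : x2 ^ 2 + x1 ^ 2 ≠ 0 := by rwa [add_comm]
  simp only [lap, pd3_V1, pd1, pd2, V1_eq_fst, V1_eq_snd]
  rw [deriv_deriv_affine_div_add _ _ _ _ h, deriv_deriv_affine_div_add _ _ _ _ h',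
    add_comm (x2 ^ 2)]
  simp only [pd3, Pi.zero_apply, deriv_const]
  field_simp
  ring

/-- Away from the axis the second velocity component is harmonic. -/
lemma lap_V2 (h : x1 ^ 2 + x2 ^ 2 ≠ 0) : lap (V2 T a k) t x1 x2 x3 = 0 := by
  have h' : x2 ^ 2 + x1 ^ 2 ≠ 0 := by rwa [add_comm]
  simp only [lap, pd3_V2, pd1, pd2, V2_eq_fst, V2_eq_snd]
  rw [deriv_deriv_affine_div_add _ _ _ _ h, deriv_deriv_affine_div_add _ _ _ _ h',
    add_comm (x2 ^ 2)]
  simp only [pd3, Pi.zero_apply, deriv_const]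
  field_simp
  ring

variable (t x1 x2)

lemma lap_V3 : lap (V3 T a) t x1 x2 x3 = 0 := by
  rw [lap, pd1_V3, pd2_V3, pd3_V3]
  simp [pd1, pd2, pd3]

variable {t x1 x2}

lemma deriv_pressure_profile {x c : ℝ} (p q r : ℝ) (h : x ^ 2 + c ≠ 0) :
    deriv (fun z => p * (z ^ 2 + c) + q / (z ^ 2 + c) + r) x =
      2 * p * x - 2 * q * x / (x ^ 2 + c) ^ 2 := by
  have hd := hasDerivAt_sq_add_const x c
  refine Eq.trans (((hd.const_mul p).add ((hasDerivAt_const x q).div hd h)).add_const r).deriv ?_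
  ring

lemma pd1_Pr1 (h : x1 ^ 2 + x2 ^ 2 ≠ 0) : pd1 (Pr1 T a k) t x1 x2 x3 =
    -(a * (a + 1) * x1) / (T - t) ^ 2 + k ^ 2 * x1 / (x1 ^ 2 + x2 ^ 2) ^ 2 := by
  have e : (fun y => Pr1 T a k t y x2 x3) = fun z =>
      -(1 / 2) * (a * (a + 1)) / (T - t) ^ 2 * (z ^ 2 + x2 ^ 2) +
        -(1 / 2) * k ^ 2 / (z ^ 2 + x2 ^ 2) + a * (1 - 2 * a) * x3 ^ 2 / (T - t) ^ 2 := by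
    funext z; simp only [Pr1]; ring
  rw [pd1, e, deriv_pressure_profile _ _ _ h]; ring

lemma pd2_Pr1 (h : x1 ^ 2 + x2 ^ 2 ≠ 0) : pd2 (Pr1 T a k) t x1 x2 x3 =
    -(a * (a + 1) * x2) / (T - t) ^ 2 + k ^ 2 * x2 / (x1 ^ 2 + x2 ^ 2) ^ 2 := by
  have e : (fun y => Pr1 T a k t x1 y x3) = fun z =>
      -(1 / 2) * (a * (a + 1)) / (T - t) ^ 2 * (z ^ 2 + x1 ^ 2) +
        -(1 / 2) * k ^ 2 / (z ^ 2 + x1 ^ 2) + a * (1 - 2 * a) * x3 ^ 2 / (T - t) ^ 2 := by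
    funext z; simp only [Pr1]; ring
  rw [pd2, e, deriv_pressure_profile _ _ _ (by rwa [add_comm]), add_comm (x2 ^ 2)]; ring

lemma pd3_Pr1 : pd3 (Pr1 T a k) t x1 x2 x3 = 2 * a * (1 - 2 * a) * x3 / (T - t) ^ 2 := by
  have h := (((hasDerivAt_pow 2 x3).const_mul (a * (1 - 2 * a))).div_const
    ((T - t) ^ 2)).const_add (-(1 / 2) * (a * (a + 1) * (x1 ^ 2 + x2 ^ 2) / (T - t) ^ 2 +
      k ^ 2 / (x1 ^ 2 + x2 ^ 2)))
  refine Eq.trans h.deriv ?_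
  push_cast
  ring

end

/-- The first explicit family of blowup solutions for the 3D incompressible
Navier–Stokes equations: momentum equation `∂ₜv + (v·∇)v + ∇P = ν Δv` and
`∇·v = 0` at every point with `0 ≤ t < T*` and `x₁² + x₂² ≠ 0`. -/
theorem first_family_navier_stokes (T ν a k : ℝ) (hT : 0 < T) (hν : 0 ≤ ν) (ha0 : a ≠ 0)
    (hk : k ≠ 0) (t x1 x2 x3 : ℝ) (ht0 : 0 ≤ t) (htT : t < T)
    (hx : x1 ^ 2 + x2 ^ 2 ≠ 0) :
    nsMomEq ν (V1 T a k) (V2 T a k) (V3 T a) (Pr1 T a k) t x1 x2 x3 ∧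
    divg (V1 T a k) (V2 T a k) (V3 T a) t x1 x2 x3 = 0 := by
  have hτ : T - t ≠ 0 := (sub_pos.mpr htT).ne'
  refine ⟨⟨?_, ?_, ?_⟩, ?_⟩
  · rw [pdt_V1 _ _ _ hτ, pd1_V1 _ _ _ hx, pd2_V1 _ _ _ hx, pd3_V1, pd1_Pr1 _ _ _ hx,
      lap_V1 _ _ _ hx]
    simp only [V1, V2, Pi.zero_apply]
    field_simp
    ring
  · rw [pdt_V2 _ _ _ hτ, pd1_V2 _ _ _ hx, pd2_V2 _ _ _ hx, pd3_V2, pd2_Pr1 _ _ _ hx,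
      lap_V2 _ _ _ hx]
    simp only [V1, V2, Pi.zero_apply]
    field_simp
    ring
  · rw [pdt_V3 _ _ hτ, pd1_V3, pd2_V3, pd3_V3, pd3_Pr1, lap_V3]
    simp only [V3, Pi.zero_apply]
    field_simp
    ring
  · rw [divg, pd1_V1 _ _ _ hx, pd2_V2 _ _ _ hx, pd3_V3]
    ring
end
end

section
/- Independence of the viscosity for the explicit solutions: let T* > 0, k ≠ 0, ā ≠ 0, and a ∈ ℝ with a ∉ {−1/2, 0}. Then for all 0 ≤ t < T* and all x ∈ ℝ³ with x₁² + x₂² ≠ 0, the fields v(t,x) = (a x₁/(T*−t) + k x₂/(x₁²+x₂²), a x₂/(T*−t) − k x₁/(x₁²+x₂²), −2a x₃/(T*−t)) and H(t,x) = (ā x₁ + 2āk x₂(T*−t)/((2a+1)(x₁²+x₂²)), ā x₂ − 2āk x₁(T*−t)/((2a+1)(x₁²+x₂²)), −2ā x₃) are harmonic in the spatial variable: Δv(t,x) = 0 and ΔH(t,x) = 0 componentwise. Consequently the equations they satisfy are independent of the viscosity constant ν, so the same fields solve the ideal (ν = 0) MHD equations. -/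
set_option linter.unusedVariables false

open Real Filter

noncomputable section

/-- The second derivative of an affine function plus `(c * y + e) / (y ^ 2 + m)`. -/
lemma deriv_deriv_affine_add_div (A B c e m x : ℝ) (hx : x ^ 2 + m ≠ 0) :
    deriv (fun z => deriv (fun y => A * y + B + (c * y + e) / (y ^ 2 + m)) z) x =
      ((-2 * c * x - 2 * e) * (x ^ 2 + m) - 4 * x * (c * m - c * x ^ 2 - 2 * e * x)) /
        (x ^ 2 + m) ^ 3 := by
  have hden (z : ℝ) : HasDerivAt (fun y : ℝ => y ^ 2 + m) (2 * z) z := by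
    simpa using (hasDerivAt_pow 2 z).add_const m
  have hlin (u v z : ℝ) : HasDerivAt (fun y : ℝ => u * y + v) u z := by
    simpa using ((hasDerivAt_id z).const_mul u).add_const v
  have hfirst : (fun z => deriv (fun y => A * y + B + (c * y + e) / (y ^ 2 + m)) z) =ᶠ[nhds x]
      fun z => A + (c * m - c * z ^ 2 - 2 * e * z) / (z ^ 2 + m) ^ 2 := by
    have hcont : ContinuousAt (fun y : ℝ => y ^ 2 + m) x := (hden x).continuousAt
    filter_upwards [hcont.eventually_ne hx] with z hz
    refine HasDerivAt.deriv ?_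
    convert (hlin A B z).fun_add ((hlin c e z).fun_div (hden z) hz) using 3
    ring
  have hnum : HasDerivAt (fun z : ℝ => c * m - c * z ^ 2 - 2 * e * z) (-2 * c * x - 2 * e) x := by
    refine ((((hasDerivAt_pow 2 x).const_mul c).const_sub (c * m)).fun_sub
      ((hasDerivAt_id' x).const_mul (2 * e))).congr_deriv ?_
    norm_num
    ring
  rw [hfirst.deriv_eq,
    ((hnum.fun_div ((hden x).fun_pow 2) (pow_ne_zero 2 hx)).const_add A).deriv]
  field_simp
  norm_num
  ring

/-- Off the `x₃`-axis, a linear field plus a combination of `x₁ / (x₁² + x₂²)` and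
`x₂ / (x₁² + x₂²)` is harmonic. -/
lemma lap_eq_zero_of_linear_add_dipole {f : F} {t : ℝ} (p q r c d : ℝ)
    (hf : ∀ x1 x2 x3, f t x1 x2 x3 =
      p * x1 + q * x2 + r * x3 + (c * x1 + d * x2) / (x1 ^ 2 + x2 ^ 2))
    {x1 x2 : ℝ} (x3 : ℝ) (hx : x1 ^ 2 + x2 ^ 2 ≠ 0) : lap f t x1 x2 x3 = 0 := by
  have hslice1 : (fun y => f t y x2 x3) = fun y =>
      p * y + (q * x2 + r * x3) + (c * y + d * x2) / (y ^ 2 + x2 ^ 2) := by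
    funext y
    rw [hf]
    ring
  have hslice2 : (fun y => f t x1 y x3) = fun y =>
      q * y + (p * x1 + r * x3) + (d * y + c * x1) / (y ^ 2 + x1 ^ 2) := by
    funext y
    rw [hf, add_comm (x1 ^ 2)]
    ring
  have h3 : pd3 (pd3 f) t x1 x2 x3 = 0 := by
    unfold pd3
    simp [hf]
  rw [lap, h3]
  unfold pd1 pd2
  rw [hslice1, hslice2, deriv_deriv_affine_add_div _ _ _ _ _ _ hx,
    deriv_deriv_affine_add_div _ _ _ _ _ _ (by rwa [add_comm]), add_comm (x2 ^ 2)]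
  field_simp
  ring

/-- Independence of the viscosity for the first explicit family: both the velocity
field and the magnetic field are harmonic in the spatial variable
(`Δv = 0` and `ΔH = 0` componentwise) at every point with `0 ≤ t < T*` and
`x₁² + x₂² ≠ 0`, so the viscous terms vanish and the equations are independent of the
viscosity `ν`. -/
theorem first_family_harmonic (T a k ab : ℝ) (hT : 0 < T) (hk : k ≠ 0) (hab : ab ≠ 0)
    (ha : a ≠ -(1 / 2)) (ha0 : a ≠ 0) (t x1 x2 x3 : ℝ) (ht0 : 0 ≤ t) (htT : t < T)
    (hx : x1 ^ 2 + x2 ^ 2 ≠ 0) :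
    lap (V1 T a k) t x1 x2 x3 = 0 ∧ lap (V2 T a k) t x1 x2 x3 = 0 ∧
    lap (V3 T a) t x1 x2 x3 = 0 ∧ lap (B1 T a k ab) t x1 x2 x3 = 0 ∧
    lap (B2 T a k ab) t x1 x2 x3 = 0 ∧ lap (B3 ab) t x1 x2 x3 = 0 := by
  refine ⟨lap_eq_zero_of_linear_add_dipole (a / (T - t)) 0 0 0 k ?_ x3 hx,
    lap_eq_zero_of_linear_add_dipole 0 (a / (T - t)) 0 (-k) 0 ?_ x3 hx,
    lap_eq_zero_of_linear_add_dipole 0 0 (-(2 * a) / (T - t)) 0 0 ?_ x3 hx,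
    lap_eq_zero_of_linear_add_dipole ab 0 0 0 (2 * ab * k * (T - t) / (2 * a + 1)) ?_ x3 hx,
    lap_eq_zero_of_linear_add_dipole 0 ab 0 (-(2 * ab * k * (T - t) / (2 * a + 1))) 0 ?_ x3 hx,
    lap_eq_zero_of_linear_add_dipole 0 0 (-(2 * ab)) 0 0 ?_ x3 hx⟩ <;>
  intro y1 y2 y3 <;>
  simp only [V1, V2, V3, B1, B2, B3, div_eq_mul_inv, mul_inv] <;>
  ring
end
end
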